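/- Let 0 < δ ≤ 1 and let s < −2. Then the family (k,h) ↦ ‖k‖^{2s}·α_{k,h}² / (‖h‖²·‖k−h‖²), indexed by pairs (k,h) ∈ ℤ² × ℤ² with k ≠ 0, h ≠ 0, h ≠ k, is summable; i.e. Σ_{k ≠ 0} ‖k‖^{2s} Σ_{h ≠ 0, h ≠ k} α_{k,h}² / (‖h‖²·‖k−h‖²) < ∞. -/

import Mathlib

/-- The Euclidean norm of a lattice point `k ∈ ℤ²`. -/
noncomputable def znorm (k : ℤ × ℤ) : ℝ := Real.sqrt ((k.1 : ℝ) ^ 2 + (k.2 : ℝ) ^ 2)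

/-- `h^⊥ · k` where `h^⊥ = (−h₂, h₁)` and `·` is the standard dot product. -/
def perpDot (h k : ℤ × ℤ) : ℝ := ((-h.2 * k.1 + h.1 * k.2 : ℤ) : ℝ)

/-- The interaction coefficient
`α_{k,h} = (1/2)·((h^⊥·k)/‖k‖)·(‖k−h‖^{−δ}‖h‖ − ‖h‖^{−δ}‖k−h‖)`
of the modified SQG nonlinearity. -/
noncomputable def alphaCoef (δ : ℝ) (k h : ℤ × ℤ) : ℝ :=
  (1 / 2) * (perpDot h k / znorm k) *
    (znorm (k - h) ^ (-δ) * znorm h - znorm h ^ (-δ) * znorm (k - h))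

theorem znorm_nonneg (k : ℤ × ℤ) : 0 ≤ znorm k := Real.sqrt_nonneg _

theorem znorm_sq (k : ℤ × ℤ) : znorm k ^ 2 = (k.1 : ℝ) ^ 2 + (k.2 : ℝ) ^ 2 :=
  Real.sq_sqrt (by positivity)

theorem znorm_pos {k : ℤ × ℤ} (hk : k ≠ 0) : 0 < znorm k := by
  refine Real.sqrt_pos.2 ?_
  have : k.1 ≠ 0 ∨ k.2 ≠ 0 := by
    by_contra! h
    exact hk (Prod.ext h.1 h.2)
  rcases this with h | h
  · have : (k.1 : ℝ) ≠ 0 := by exact_mod_cast h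
    positivity
  · have : (k.2 : ℝ) ≠ 0 := by exact_mod_cast h
    positivity

theorem znorm_eq_norm (k : ℤ × ℤ) : znorm k = ‖(k.1 : ℂ) + k.2 * Complex.I‖ := by
  have := Complex.norm_add_mul_I (k.1 : ℝ) (k.2 : ℝ)
  push_cast at this
  exact this.symm

theorem znorm_sub_znorm_sub_le (k h : ℤ × ℤ) : znorm h - znorm (k - h) ≤ znorm k := by
  simp only [znorm_eq_norm, Prod.fst_sub, Prod.snd_sub]
  have := norm_sub_le ((k.1 : ℂ) + k.2 * Complex.I)
    (((k.1 - h.1 : ℤ) : ℂ) + ((k.2 - h.2 : ℤ) : ℂ) * Complex.I)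
  rw [show (k.1 : ℂ) + k.2 * Complex.I -
    (((k.1 - h.1 : ℤ) : ℂ) + ((k.2 - h.2 : ℤ) : ℂ) * Complex.I) =
      (h.1 : ℂ) + h.2 * Complex.I by push_cast; ring] at this
  linarith

theorem perpDot_sub_left (k h : ℤ × ℤ) : perpDot (k - h) k = -perpDot h k := by
  simp only [perpDot, Prod.fst_sub, Prod.snd_sub]
  push_cast
  ring

theorem perpDot_sq_le (h k : ℤ × ℤ) : perpDot h k ^ 2 ≤ znorm h ^ 2 * znorm k ^ 2 := by
  rw [znorm_sq, znorm_sq, perpDot]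
  push_cast
  nlinarith [sq_nonneg ((h.1 : ℝ) * k.1 + h.2 * k.2)]

theorem alphaCoef_sub (δ : ℝ) (k h : ℤ × ℤ) : alphaCoef δ k (k - h) = alphaCoef δ k h := by
  simp only [alphaCoef, perpDot_sub_left, sub_sub_cancel]
  ring

/-- `‖k‖ ^ r` is summable over `k ∈ ℤ²` as soon as `r < -2`. -/
theorem summable_znorm_rpow {r : ℝ} (hr : r < -2) : Summable fun k : ℤ × ℤ => znorm k ^ r := by
  have h := EisensteinSeries.summable_one_div_norm_rpow (k := -r) (by linarith)
  rw [← (finTwoArrowEquiv ℤ).symm.summable_iff] at h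
  refine h.of_nonneg_of_le (fun k => Real.rpow_nonneg (znorm_nonneg k) _) fun k => ?_
  by_cases hk : k = 0
  · subst hk
    rw [show znorm 0 = 0 by simp [znorm], Real.zero_rpow (by linarith)]
    exact Real.rpow_nonneg (norm_nonneg _) _
  simp only [Function.comp_apply, neg_neg]
  refine Real.rpow_le_rpow_of_nonpos ?_ ?_ (by linarith)
  · exact norm_pos_iff.2 fun h0 => hk ((finTwoArrowEquiv ℤ).symm.injective (by
      rw [h0]; ext i; fin_cases i <;> rfl))
  · refine (pi_norm_le_iff_of_nonneg (znorm_nonneg k)).2 fun i => ?_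
    fin_cases i
    · exact Real.abs_le_sqrt (le_add_of_nonneg_right (by positivity))
    · exact Real.abs_le_sqrt (le_add_of_nonneg_left (by positivity))

theorem rpow_neg_mul_sub_le {δ a b : ℝ} (hδ : 0 < δ) (hδ1 : δ ≤ 1) (hb : 0 < b) (hab : b ≤ a) :
    |b ^ (-δ) * a - a ^ (-δ) * b| ≤ 2 * b ^ (-δ) * (a - b) := by
  have ha : 0 < a := hb.trans_le hab
  have hX : 0 < b ^ (-δ) := Real.rpow_pos_of_pos hb _
  have hle : a ^ (-δ) ≤ b ^ (-δ) := Real.rpow_le_rpow_of_nonpos hb hab (by linarith)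
  have hge : b ^ (-δ) * (b / a) ≤ a ^ (-δ) := by
    have h1 : b / a ≤ (b / a) ^ δ := by
      simpa using Real.rpow_le_rpow_of_exponent_ge (div_pos hb ha) ((div_le_one ha).2 hab) hδ1
    calc b ^ (-δ) * (b / a) ≤ b ^ (-δ) * (b / a) ^ δ := by gcongr
      _ = a ^ (-δ) := by
        rw [Real.div_rpow hb.le ha.le, Real.rpow_neg hb.le, Real.rpow_neg ha.le]
        have := (Real.rpow_pos_of_pos hb δ).ne'
        field_simp
  have hsq : 2 * b - a ≤ b / a * b := by
    rw [div_mul_eq_mul_div, le_div_iff₀ ha]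
    nlinarith [sq_nonneg (a - b)]
  rw [abs_of_nonneg (sub_nonneg.2 (by gcongr))]
  nlinarith [mul_le_mul_of_nonneg_left hsq hX.le, mul_le_mul_of_nonneg_right hge hb.le]

theorem alphaCoef_sq_div_le_of_le {δ : ℝ} (hδ : 0 < δ) (hδ1 : δ ≤ 1) {k h : ℤ × ℤ} (hk : k ≠ 0)
    (hkh : k - h ≠ 0) (hle : znorm (k - h) ≤ znorm h) :
    alphaCoef δ k h ^ 2 / (znorm h ^ 2 * znorm (k - h) ^ 2) ≤
      znorm k ^ (2 : ℝ) * znorm (k - h) ^ (-2 - 2 * δ) := by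
  have hK := znorm_pos hk
  have hb := znorm_pos hkh
  have hP : perpDot h k ^ 2 ≤ znorm (k - h) ^ 2 * znorm k ^ 2 := by
    simpa [perpDot_sub_left] using perpDot_sq_le (k - h) k
  have hD := rpow_neg_mul_sub_le hδ hδ1 hb hle
  have hT := znorm_sub_znorm_sub_le k h
  rw [alphaCoef, show -2 - 2 * δ = -δ * (2 : ℕ) - (2 : ℕ) by push_cast; ring,
    Real.rpow_sub_natCast hb.ne', Real.rpow_mul_natCast hb.le, Real.rpow_two]
  generalize perpDot h k = P at *
  generalize znorm k = K at *
  generalize znorm (k - h) = b at *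
  generalize znorm h = a at *
  have hX : 0 < b ^ (-δ) := Real.rpow_pos_of_pos hb _
  generalize b ^ (-δ) * a - a ^ (-δ) * b = D at *
  generalize b ^ (-δ) = X at *
  have hD2 : D ^ 2 ≤ (2 * X * K) ^ 2 := sq_le_sq' (by nlinarith [abs_le.1 hD]) (by
    nlinarith [abs_le.1 hD])
  have hP2 : P ^ 2 / K ^ 2 ≤ b ^ 2 := (div_le_iff₀ (by positivity)).2 hP
  have ha : 0 < a := hb.trans_le hle
  calc (1 / 2 * (P / K) * D) ^ 2 / (a ^ 2 * b ^ 2)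
      = 1 / 4 * (P ^ 2 / K ^ 2) * D ^ 2 / (a ^ 2 * b ^ 2) := by ring
    _ ≤ 1 / 4 * b ^ 2 * (2 * X * K) ^ 2 / (b ^ 2 * b ^ 2) := by gcongr
    _ = K ^ 2 * (X ^ 2 / b ^ 2) := by field_simp; ring

theorem alphaCoef_sq_div_le {δ : ℝ} (hδ : 0 < δ) (hδ1 : δ ≤ 1) {k h : ℤ × ℤ} (hk : k ≠ 0)
    (hh : h ≠ 0) (hkh : h ≠ k) :
    alphaCoef δ k h ^ 2 / (znorm h ^ 2 * znorm (k - h) ^ 2) ≤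
      znorm k ^ (2 : ℝ) * (znorm h ^ (-2 - 2 * δ) + znorm (k - h) ^ (-2 - 2 * δ)) := by
  have hK := Real.rpow_nonneg (znorm_nonneg k) 2
  have h1 := mul_nonneg hK (Real.rpow_nonneg (znorm_nonneg h) (-2 - 2 * δ))
  have h2 := mul_nonneg hK (Real.rpow_nonneg (znorm_nonneg (k - h)) (-2 - 2 * δ))
  rw [mul_add]
  rcases le_total (znorm (k - h)) (znorm h) with hle | hle
  · have := alphaCoef_sq_div_le_of_le hδ hδ1 hk (sub_ne_zero.2 hkh.symm) hle
    linarith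
  · have := alphaCoef_sq_div_le_of_le hδ hδ1 (h := k - h) hk (by simpa using hh) (by simpa using hle)
    rw [alphaCoef_sub, sub_sub_cancel, mul_comm (znorm (k - h) ^ 2)] at this
    linarith

/-- Proposition 4.1: for `0 < δ ≤ 1` and `s < −2` the family
`(k,h) ↦ ‖k‖^{2s}·α_{k,h}²/(‖h‖²·‖k−h‖²)`, indexed by pairs `(k,h)` with
`k ≠ 0`, `h ≠ 0`, `h ≠ k`, is summable. -/
theorem expectation_summable (δ s : ℝ) (hδ : 0 < δ) (hδ1 : δ ≤ 1) (hs : s < -2) :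
    Summable (fun p : {p : (ℤ × ℤ) × (ℤ × ℤ) // p.1 ≠ 0 ∧ p.2 ≠ 0 ∧ p.2 ≠ p.1} =>
      znorm p.1.1 ^ (2 * s) *
        (alphaCoef δ p.1.1 p.1.2 ^ 2
          / (znorm p.1.2 ^ 2 * znorm (p.1.1 - p.1.2) ^ 2))) := by
  have hprod : Summable fun p : (ℤ × ℤ) × (ℤ × ℤ) =>
      znorm p.1 ^ (2 * s + 2) * znorm p.2 ^ (-2 - 2 * δ) :=
    (summable_znorm_rpow (by linarith)).mul_of_nonneg (summable_znorm_rpow (by linarith))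
      (fun k => Real.rpow_nonneg (znorm_nonneg k) _) fun h => Real.rpow_nonneg (znorm_nonneg h) _
  have hshear : Function.Injective fun p : (ℤ × ℤ) × (ℤ × ℤ) => (p.1, p.1 - p.2) := by
    rintro ⟨k, h⟩ ⟨k', h'⟩ heq
    obtain ⟨rfl, h2⟩ := Prod.mk.inj heq
    exact Prod.ext rfl (sub_right_injective h2)
  refine ((hprod.add (hprod.comp_injective hshear)).comp_injective
    Subtype.val_injective).of_nonneg_of_le (fun p => ?_) ?_
  · exact mul_nonneg (Real.rpow_nonneg (znorm_nonneg _) _) (by positivity)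
  · rintro ⟨⟨k, h⟩, hk, hh, hkh⟩
    refine (mul_le_mul_of_nonneg_left (alphaCoef_sq_div_le hδ hδ1 hk hh hkh)
      (Real.rpow_nonneg (znorm_nonneg _) _)).trans_eq ?_
    simp only [Function.comp_apply]
    rw [Real.rpow_add (znorm_pos hk)]
    ring
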